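/- Let (x_k) be the IR-ISTA iterates with weights θ_k := 1/∏_{t=0}^{k}(1 − η_t γ μ_f) and averaged iterates x̄_K := (Σ_{k=0}^{K−1} θ_k η_k x_{k+1})/(Σ_{k=0}^{K−1} θ_k η_k). Assume Ĉ_f̄ := inf_{x∈E} f̄(x) > −∞. Then for every K ≥ 1: 0 ≤ h̄(x̄_K) − h̄* ≤ ( η_0‖x_0 − x*‖²/(2γ) + (f̄* − Ĉ_f̄)·Σ_{j=0}^{K−1} η_j² θ_j ) / ( Σ_{j=0}^{K−1} η_j θ_j ). -/

import Mathlib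

open scoped RealInnerProductSpace
open Metric Filter

noncomputable section

section Auxiliary

variable {E : Type*} [NormedAddCommGroup E] [InnerProductSpace ℝ E]

theorem le_of_forall_le_add_mul {a b c : ℝ} (H : ∀ t : ℝ, 0 < t → t < 1 → a ≤ b + t * c) :
    a ≤ b := by
  have hlim : Tendsto (fun t : ℝ => b + t * c) (nhdsWithin 0 (Set.Ioi 0)) (nhds b) := by
    have hcont : Continuous fun t : ℝ => b + t * c := by fun_prop
    simpa using (hcont.tendsto 0).mono_left nhdsWithin_le_nhds
  refine ge_of_tendsto hlim ?_
  filter_upwards [Ioo_mem_nhdsGT (zero_lt_one' ℝ)] with t ht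
  exact H t ht.1 ht.2

/-- Three-point inequality for the proximal operator of a convex function. -/
theorem ConvexOn.prox_three_point {ω : E → ℝ} (hω : ConvexOn ℝ Set.univ ω) {c : ℝ} {p y : E}
    (hp : ∀ u, ω p + c * ‖p - y‖ ^ 2 ≤ ω u + c * ‖u - y‖ ^ 2) (u : E) :
    ω p + c * ‖p - y‖ ^ 2 + c * ‖u - p‖ ^ 2 ≤ ω u + c * ‖u - y‖ ^ 2 := by
  refine le_of_forall_le_add_mul (c := c * ‖u - p‖ ^ 2) fun t ht0 ht1 => ?_
  have hc := hω.2 (Set.mem_univ p) (Set.mem_univ u) (sub_nonneg.2 ht1.le) ht0.le (by ring)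
  have hm := hp ((1 - t) • p + t • u)
  have e1 : (1 - t) • p + t • u - y = (p - y) + t • (u - p) := by module
  have e2 : u - y = (p - y) + (u - p) := by abel
  rw [e1, norm_add_sq_real, inner_smul_right, norm_smul, Real.norm_of_nonneg ht0.le] at hm
  rw [e2, norm_add_sq_real]
  simp only [smul_eq_mul] at hc
  refine le_of_mul_le_mul_left ?_ ht0
  linarith

theorem HasGradientAt.hasDerivAt_line [CompleteSpace E] {F : E → ℝ} {g x d : E} {t : ℝ}
    (hg : HasGradientAt F g (x + t • d)) :
    HasDerivAt (fun s : ℝ => F (x + s • d)) ⟪g, d⟫ t := by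
  have h1 : HasDerivAt (fun s : ℝ => x + s • d) d t :=
    (((hasDerivAt_id t).smul_const d).const_add x).congr_deriv (one_smul ℝ d)
  exact hg.hasFDerivAt.comp_hasDerivAt t h1

/-- A differentiable function with Lipschitz gradient lies below its quadratic upper model. -/
theorem le_quadratic_of_lipschitz_gradient [CompleteSpace E] {F : E → ℝ} {F' : E → E} {L : ℝ}
    (hF : ∀ x, HasGradientAt F (F' x) x) (hL : ∀ x y, ‖F' x - F' y‖ ≤ L * ‖x - y‖) (x y : E) :
    F y ≤ F x + ⟪F' x, y - x⟫ + L / 2 * ‖y - x‖ ^ 2 := by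
  set d := y - x with hd
  have hφ (t : ℝ) : HasDerivAt
      (fun s : ℝ => F (x + s • d) - (s * ⟪F' x, d⟫ + s ^ 2 * (L / 2 * ‖d‖ ^ 2)))
      (⟪F' (x + t • d), d⟫ - (⟪F' x, d⟫ + t * (L * ‖d‖ ^ 2))) t := by
    refine ((hF (x + t • d)).hasDerivAt_line.sub (((hasDerivAt_id t).mul_const ⟪F' x, d⟫).add
      (((hasDerivAt_id t).pow 2).mul_const (L / 2 * ‖d‖ ^ 2)))).congr_deriv ?_
    simp
    ring
  have hanti := antitoneOn_of_deriv_nonpos (convex_Icc (0 : ℝ) 1)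
    (fun t _ => (hφ t).continuousAt.continuousWithinAt)
    (fun t _ => (hφ t).differentiableAt.differentiableWithinAt) (fun t ht => by
      rw [interior_Icc] at ht
      rw [(hφ t).deriv]
      have h1 := real_inner_le_norm (F' (x + t • d) - F' x) d
      have h2 := hL (x + t • d) x
      rw [add_sub_cancel_left, norm_smul, Real.norm_of_nonneg ht.1.le] at h2
      have h3 := mul_le_mul_of_nonneg_right h2 (norm_nonneg d)
      rw [inner_sub_left] at h1
      linarith)
  have h01 := hanti (Set.left_mem_Icc.2 zero_le_one) (Set.right_mem_Icc.2 zero_le_one) zero_le_one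
  have hy : x + (1 : ℝ) • d = y := by simp [hd]
  simp only [hy, zero_smul, add_zero] at h01
  linarith

/-- A differentiable strongly convex function lies above its quadratic lower model. -/
theorem StrongConvexOn.quadratic_le [CompleteSpace E] {F : E → ℝ} {m : ℝ} {g x : E}
    (hF : StrongConvexOn Set.univ m F) (hg : HasGradientAt F g x) (u : E) :
    F x + ⟪g, u - x⟫ + m / 2 * ‖u - x‖ ^ 2 ≤ F u := by
  have hline : HasDerivAt (fun s : ℝ => F (x + s • (u - x))) ⟪g, u - x⟫ 0 :=
    HasGradientAt.hasDerivAt_line (by simpa using hg)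
  have hbound : ⟪g, u - x⟫ ≤ F u - F x - m / 2 * ‖u - x‖ ^ 2 := by
    have hcont : Continuous fun t : ℝ => F u - F x - (1 - t) * (m / 2 * ‖u - x‖ ^ 2) := by
      fun_prop
    have hlim : Tendsto (fun t : ℝ => F u - F x - (1 - t) * (m / 2 * ‖u - x‖ ^ 2))
        (nhdsWithin 0 (Set.Ioi 0)) (nhds (F u - F x - m / 2 * ‖u - x‖ ^ 2)) := by
      simpa using (hcont.tendsto 0).mono_left nhdsWithin_le_nhds
    refine le_of_tendsto_of_tendsto hline.tendsto_slope_zero_right hlim ?_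
    filter_upwards [Ioo_mem_nhdsGT (zero_lt_one' ℝ)] with t ht
    have hc := hF.2 (Set.mem_univ x) (Set.mem_univ u) (sub_nonneg.2 ht.2.le) ht.1.le (by ring)
    have e1 : (1 - t) • x + t • u = x + t • (u - x) := by module
    rw [e1, norm_sub_rev x u] at hc
    simp only [smul_eq_mul, zero_add, zero_smul, add_zero] at hc ⊢
    rw [inv_mul_le_iff₀ ht.1]
    linarith
  linarith

/-- One step of the proximal gradient method on `G + ω`, with `G` strongly convex and smooth. -/
theorem prox_gradient_step {ω G : E → ℝ} (hω : ConvexOn ℝ Set.univ ω) {γ m : ℝ} (hγ : 0 < γ)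
    {x p g u : E}
    (hp : ∀ v, ω p + 1 / (2 * γ) * ‖p - (x - γ • g)‖ ^ 2
      ≤ ω v + 1 / (2 * γ) * ‖v - (x - γ • g)‖ ^ 2)
    (hup : G p ≤ G x + ⟪g, p - x⟫ + 1 / (2 * γ) * ‖p - x‖ ^ 2)
    (hlow : G x + ⟪g, u - x⟫ + m / 2 * ‖u - x‖ ^ 2 ≤ G u) :
    G p + ω p + 1 / (2 * γ) * ‖p - u‖ ^ 2
      ≤ G u + ω u + (1 - γ * m) * (1 / (2 * γ) * ‖x - u‖ ^ 2) := by
  have h3 := hω.prox_three_point hp u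
  have expand (v : E) : 1 / (2 * γ) * ‖v - (x - γ • g)‖ ^ 2
      = 1 / (2 * γ) * ‖v - x‖ ^ 2 + ⟪g, v - x⟫ + γ / 2 * ‖g‖ ^ 2 := by
    have e : v - (x - γ • g) = (v - x) + γ • g := by abel
    rw [e, norm_add_sq_real, inner_smul_right, norm_smul, Real.norm_of_nonneg hγ.le,
      real_inner_comm]
    field_simp
  rw [expand, expand] at h3
  rw [norm_sub_rev p u, norm_sub_rev x u]
  have e : (1 - γ * m) * (1 / (2 * γ) * ‖u - x‖ ^ 2)
      = 1 / (2 * γ) * ‖u - x‖ ^ 2 - m / 2 * ‖u - x‖ ^ 2 := by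
    field_simp
  linarith

end Auxiliary

theorem stmt_10
    {n : ℕ}
    (f h ωf ωh : EuclideanSpace ℝ (Fin n) → ℝ)
    (f' h' : EuclideanSpace ℝ (Fin n) → EuclideanSpace ℝ (Fin n))
    (Lf Lh μf : ℝ)
    (hμf_pos : 0 < μf) (hμf_le : μf ≤ Lf) (hLh_pos : 0 < Lh)
    (hf_grad : ∀ x, HasGradientAt f (f' x) x)
    (hf_lip : ∀ x y, ‖f' x - f' y‖ ≤ Lf * ‖x - y‖)
    (hf_sc : StrongConvexOn Set.univ μf f)
    (hh_grad : ∀ x, HasGradientAt h (h' x) x)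
    (hh_lip : ∀ x y, ‖h' x - h' y‖ ≤ Lh * ‖x - y‖)
    (hh_conv : ConvexOn ℝ Set.univ h)
    (hωf_conv : ConvexOn ℝ Set.univ ωf)
    (hωh_conv : ConvexOn ℝ Set.univ ωh)
    (fbar hbar : EuclideanSpace ℝ (Fin n) → ℝ)
    (hfbar : ∀ x, fbar x = f x + ωf x)
    (hhbar : ∀ x, hbar x = h x + ωh x)
    (X : Set (EuclideanSpace ℝ (Fin n)))
    (hX : X = {z | ∀ y, hbar z ≤ hbar y})
    (hXne : X.Nonempty)
    (hstar : ℝ)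
    (hhstar : IsGLB (Set.range hbar) hstar)
    (xstar : EuclideanSpace ℝ (Fin n))
    (hxstar_mem : xstar ∈ X)
    (hxstar_min : ∀ y ∈ X, fbar xstar ≤ fbar y)
    (x : ℕ → EuclideanSpace ℝ (Fin n))
    (η : ℕ → ℝ) (γ : ℝ)
    (hη_pos : ∀ k, 0 < η k)
    (hη_mono : ∀ k, η (k+1) ≤ η k)
    (hγ_pos : 0 < γ)
    (hγ_le : γ ≤ 1 / (Lh + η 0 * Lf))
    (hx_iter : ∀ k u,
      ωh (x (k+1)) + η k * ωf (x (k+1))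
        + 1 / (2*γ) * ‖x (k+1) - (x k - γ • (h' (x k) + η k • f' (x k)))‖ ^ 2
      ≤ ωh u + η k * ωf u
        + 1 / (2*γ) * ‖u - (x k - γ • (h' (x k) + η k • f' (x k)))‖ ^ 2)
    (θ : ℕ → ℝ)
    (hθ : ∀ k, θ k = 1 / ∏ t ∈ Finset.range (k+1), (1 - η t * γ * μf))
    (xbar : ℕ → EuclideanSpace ℝ (Fin n))
    (hxbar : ∀ K, xbar K = (∑ j ∈ Finset.range K, θ j * η j)⁻¹ •
        ∑ k ∈ Finset.range K, (θ k * η k) • x (k+1))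
    (Cf : ℝ)
    (hCf : IsGLB (Set.range fbar) Cf)
    :
    ∀ K : ℕ, 1 ≤ K →
      0 ≤ hbar (xbar K) - hstar
      ∧ hbar (xbar K) - hstar
          ≤ (η 0 * ‖x 0 - xstar‖ ^ 2 / (2 * γ)
              + (fbar xstar - Cf) * ∑ j ∈ Finset.range K, η j ^ 2 * θ j)
            / (∑ j ∈ Finset.range K, η j * θ j) := by
  have hLf : 0 < Lf := hμf_pos.trans_le hμf_le
  have hη_anti : ∀ k, η k ≤ η 0 := fun k => antitone_nat_of_succ_le hη_mono (Nat.zero_le k)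
  have hγL (k : ℕ) : γ * (Lh + η k * Lf) ≤ 1 := by
    have h0 : 0 < Lh + η 0 * Lf := add_pos hLh_pos (mul_pos (hη_pos 0) hLf)
    rw [le_div_iff₀ h0] at hγ_le
    refine le_trans ?_ hγ_le
    gcongr
    exact hη_anti k
  have hρ_pos (k : ℕ) : 0 < 1 - η k * γ * μf := by
    have h1 : η k * γ * μf ≤ η k * γ * Lf :=
      mul_le_mul_of_nonneg_left hμf_le (mul_pos (hη_pos k) hγ_pos).le
    have h2 := hγL k
    have h3 : 0 < γ * Lh := mul_pos hγ_pos hLh_pos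
    linarith
  have hθ_pos (k : ℕ) : 0 < θ k := by
    rw [hθ]
    exact one_div_pos.2 (Finset.prod_pos fun t _ => hρ_pos t)
  have hstar_eq : hstar = hbar xstar := by
    rw [hX] at hxstar_mem
    refine le_antisymm (hhstar.1 ⟨xstar, rfl⟩) (hhstar.2 ?_)
    rintro _ ⟨y, rfl⟩
    exact hxstar_mem y
  have hstar_le (y : EuclideanSpace ℝ (Fin n)) : hstar ≤ hbar y := hhstar.1 ⟨y, rfl⟩
  have hCf_le (y : EuclideanSpace ℝ (Fin n)) : Cf ≤ fbar y := hCf.1 ⟨y, rfl⟩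
  have hstep (k : ℕ) : hbar (x (k + 1)) - hstar + 1 / (2 * γ) * ‖x (k + 1) - xstar‖ ^ 2
      ≤ η k * (fbar xstar - Cf)
        + (1 - η k * γ * μf) * (1 / (2 * γ) * ‖x k - xstar‖ ^ 2) := by
    have hω : ConvexOn ℝ Set.univ fun u => ωh u + η k * ωf u :=
      hωh_conv.add (hωf_conv.smul (hη_pos k).le)
    have hup : h (x (k + 1)) + η k * f (x (k + 1)) ≤ h (x k) + η k * f (x k)
        + ⟪h' (x k) + η k • f' (x k), x (k + 1) - x k⟫
        + 1 / (2 * γ) * ‖x (k + 1) - x k‖ ^ 2 := by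
      have hh := le_quadratic_of_lipschitz_gradient hh_grad hh_lip (x k) (x (k + 1))
      have hf := mul_le_mul_of_nonneg_left
        (le_quadratic_of_lipschitz_gradient hf_grad hf_lip (x k) (x (k + 1))) (hη_pos k).le
      have hc : (Lh + η k * Lf) / 2 ≤ 1 / (2 * γ) := by
        rw [div_le_div_iff₀ two_pos (mul_pos two_pos hγ_pos)]
        linarith [hγL k]
      have hcn := mul_le_mul_of_nonneg_right hc (sq_nonneg ‖x (k + 1) - x k‖)
      rw [inner_add_left, real_inner_smul_left]
      linarith
    have hlow : h (x k) + η k * f (x k) + ⟪h' (x k) + η k • f' (x k), xstar - x k⟫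
        + η k * μf / 2 * ‖xstar - x k‖ ^ 2 ≤ h xstar + η k * f xstar := by
      have hh := (strongConvexOn_zero.2 hh_conv).quadratic_le (hh_grad (x k)) xstar
      have hf := mul_le_mul_of_nonneg_left
        (hf_sc.quadratic_le (hf_grad (x k)) xstar) (hη_pos k).le
      rw [inner_add_left, real_inner_smul_left]
      linarith
    have hpg := prox_gradient_step (G := fun u => h u + η k * f u) hω hγ_pos (hx_iter k) hup hlow
    have hC := mul_le_mul_of_nonneg_left (hCf_le (x (k + 1))) (hη_pos k).le
    have e : (1 : ℝ) - γ * (η k * μf) = 1 - η k * γ * μf := by ring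
    rw [e] at hpg
    simp only [hstar_eq, hfbar, hhbar] at hC ⊢
    linarith
  have htelescope (K : ℕ) : ∑ k ∈ Finset.range K, θ k * η k * (hbar (x (k + 1)) - hstar)
      + η K * ((1 / ∏ t ∈ Finset.range K, (1 - η t * γ * μf))
        * (1 / (2 * γ) * ‖x K - xstar‖ ^ 2))
      ≤ η 0 * ‖x 0 - xstar‖ ^ 2 / (2 * γ)
        + (fbar xstar - Cf) * ∑ j ∈ Finset.range K, η j ^ 2 * θ j := by
    induction K with
    | zero =>
      refine le_of_eq ?_
      simp
      ring
    | succ K ih =>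
      have hprev : 1 / ∏ t ∈ Finset.range K, (1 - η t * γ * μf)
          = θ K * (1 - η K * γ * μf) := by
        rw [hθ, Finset.prod_range_succ, one_div, one_div, mul_inv,
          inv_mul_cancel_right₀ (hρ_pos K).ne']
      rw [hprev] at ih
      rw [← hθ, Finset.sum_range_succ, Finset.sum_range_succ]
      have hs := mul_le_mul_of_nonneg_left (hstep K) (mul_pos (hθ_pos K) (hη_pos K)).le
      have hD : 0 ≤ θ K * (1 / (2 * γ) * ‖x (K + 1) - xstar‖ ^ 2) := by
        have := hθ_pos K
        positivity
      have hη := mul_le_mul_of_nonneg_right (hη_mono K) hD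
      linarith
  intro K hK
  refine ⟨sub_nonneg.2 (hstar_le _), ?_⟩
  have hw_nonneg : ∀ k ∈ Finset.range K, 0 ≤ θ k * η k :=
    fun k _ => (mul_pos (hθ_pos k) (hη_pos k)).le
  have hW_pos : 0 < ∑ k ∈ Finset.range K, θ k * η k :=
    Finset.sum_pos (fun k _ => mul_pos (hθ_pos k) (hη_pos k))
      (Finset.nonempty_range_iff.2 (by omega))
  have hbar_conv : ConvexOn ℝ Set.univ hbar := by
    rw [show hbar = h + ωh from funext hhbar]
    exact hh_conv.add hωh_conv
  have hjensen := hbar_conv.map_centerMass_le (p := fun k => x (k + 1)) hw_nonneg hW_pos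
    fun k _ => Set.mem_univ _
  have hxc : xbar K = (Finset.range K).centerMass (fun k => θ k * η k) fun k => x (k + 1) :=
    hxbar K
  rw [← hxc] at hjensen
  simp only [Finset.centerMass, Function.comp_apply, smul_eq_mul] at hjensen
  rw [le_inv_mul_iff₀ hW_pos] at hjensen
  have hrem : 0 ≤ η K * ((1 / ∏ t ∈ Finset.range K, (1 - η t * γ * μf))
      * (1 / (2 * γ) * ‖x K - xstar‖ ^ 2)) := by
    have h1 := hη_pos K
    have h2 : 0 < ∏ t ∈ Finset.range K, (1 - η t * γ * μf) :=
      Finset.prod_pos fun t _ => hρ_pos t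
    positivity
  have ht := htelescope K
  simp only [mul_sub, Finset.sum_sub_distrib, ← Finset.sum_mul] at ht
  rw [Finset.sum_congr rfl fun j _ => mul_comm (η j) (θ j), le_div_iff₀ hW_pos]
  linarith
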